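/- arXiv:2511.01722 — 7 statements merged into one kernel-verified Lean document; each statement's English description precedes it below -/
import Mathlib

section
/- Let i ∈ V and k ∈ W be nonzero vectors. Then i ⊗ k ∈ D if and only if either (i ∈ span{s} and k ∈ B) or (k ∈ span{t} and i ∈ A). Equivalently, for one-dimensional subspaces I ⊆ V and K ⊆ W, one has I ⊗ K ⊆ D if and only if (I = span{s} and K ⊆ B) or (K = span{t} and I ⊆ A). (This characterizes the decomposable elements of a product factorization structure.) -/
open scoped TensorProduct

noncomputable section

namespace Submodule

variable {𝕂 V W : Type*} [Field 𝕂] [AddCommGroup V] [Module 𝕂 V] [AddCommGroup W] [Module 𝕂 W]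

theorem mem_or_mem_of_tmul_mem_map₂_top_sup {p : Submodule 𝕂 V} {q : Submodule 𝕂 W} {x : V} {y : W}
    (h : x ⊗ₜ[𝕂] y ∈ map₂ (TensorProduct.mk 𝕂 V W) p ⊤ ⊔ map₂ (TensorProduct.mk 𝕂 V W) ⊤ q) :
    x ∈ p ∨ y ∈ q := by
  by_contra! hxy
  obtain ⟨f, hfx, hf⟩ := exists_le_ker_of_notMem hxy.1
  obtain ⟨g, hgy, hg⟩ := exists_le_ker_of_notMem hxy.2
  have hle : map₂ (TensorProduct.mk 𝕂 V W) p ⊤ ⊔ map₂ (TensorProduct.mk 𝕂 V W) ⊤ q ≤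
      LinearMap.ker (LinearMap.mul' 𝕂 𝕂 ∘ₗ TensorProduct.map f g) := by
    refine sup_le (map₂_le.2 fun v hv w _ => ?_) (map₂_le.2 fun v _ w hw => ?_)
    · simp [LinearMap.mem_ker.1 (hf hv)]
    · simp [LinearMap.mem_ker.1 (hg hw)]
  simpa [hfx, hgy] using hle h

theorem tmul_mem_map₂_span_singleton_sup_iff {A : Submodule 𝕂 V} {B : Submodule 𝕂 W} {s : V} {t : W}
    (hs : s ∈ A) (ht : t ∈ B) {x : V} {y : W} (hx : x ≠ 0) (hy : y ≠ 0) :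
    x ⊗ₜ[𝕂] y ∈ map₂ (TensorProduct.mk 𝕂 V W) A (span 𝕂 {t}) ⊔
        map₂ (TensorProduct.mk 𝕂 V W) (span 𝕂 {s}) B ↔
      (x ∈ span 𝕂 {s} ∧ y ∈ B) ∨ (y ∈ span 𝕂 {t} ∧ x ∈ A) := by
  have hsA : span 𝕂 {s} ≤ A := (span_singleton_le_iff_mem s A).2 hs
  have htB : span 𝕂 {t} ≤ B := (span_singleton_le_iff_mem t B).2 ht
  constructor
  · intro h
    have hxA : x ∈ A := (mem_or_mem_of_tmul_mem_map₂_top_sup (q := ⊥)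
      (SetLike.le_def.1 (sup_le (le_sup_of_le_left (map₂_le_map₂ le_rfl le_top))
        (le_sup_of_le_left (map₂_le_map₂ hsA le_top))) h)).resolve_right (by simpa using hy)
    have hyB : y ∈ B := (mem_or_mem_of_tmul_mem_map₂_top_sup (p := ⊥)
      (SetLike.le_def.1 (sup_le (le_sup_of_le_right (map₂_le_map₂ le_top htB))
        (le_sup_of_le_right (map₂_le_map₂ le_top le_rfl))) h)).resolve_left (by simpa using hx)
    have hst : x ∈ span 𝕂 {s} ∨ y ∈ span 𝕂 {t} := mem_or_mem_of_tmul_mem_map₂_top_sup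
      (SetLike.le_def.1 (sup_le (le_sup_of_le_right (map₂_le_map₂ le_top le_rfl))
        (le_sup_of_le_left (map₂_le_map₂ le_rfl le_top))) h)
    exact hst.imp (⟨·, hyB⟩) (⟨·, hxA⟩)
  · rintro (⟨hxs, hyB⟩ | ⟨hyt, hxA⟩)
    · exact mem_sup_right (apply_mem_map₂ _ hxs hyB)
    · exact mem_sup_left (apply_mem_map₂ _ hxA hyt)

theorem span_singleton_eq_span_singleton_iff_mem {v s : V} (hv : v ≠ 0) :
    span 𝕂 {v} = span 𝕂 {s} ↔ v ∈ span 𝕂 {s} := by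
  refine ⟨fun h => h ▸ mem_span_singleton_self v, fun h => ?_⟩
  obtain ⟨c, rfl⟩ := mem_span_singleton.1 h
  exact span_singleton_smul_eq (IsUnit.mk0 c (left_ne_zero_of_smul hv)) s

theorem exists_eq_span_singleton_of_finrank_eq_one {p : Submodule 𝕂 V}
    (hp : Module.finrank 𝕂 p = 1) : ∃ v ≠ 0, p = span 𝕂 {v} := by
  obtain ⟨v, hvp, hv, hle⟩ :=
    (rank_submodule_eq_one_iff p).1 (Module.rank_eq_one_iff_finrank_eq_one.2 hp)
  exact ⟨v, hv, le_antisymm hle ((span_singleton_le_iff_mem v p).2 hvp)⟩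

end Submodule

/-- let `D = A ⊗ span{t} + span{s} ⊗ B ⊆ V ⊗ W`, with `s ∈ A`, `t ∈ B`
nonzero. For nonzero vectors `i ∈ V` and `k ∈ W`, `i ⊗ k ∈ D` iff
(`i ∈ span{s}` and `k ∈ B`) or (`k ∈ span{t}` and `i ∈ A`). Equivalently, for
one-dimensional subspaces `I ⊆ V` and `K ⊆ W`, `I ⊗ K ⊆ D` iff
(`I = span{s}` and `K ⊆ B`) or (`K = span{t}` and `I ⊆ A`). -/
theorem statement9 (𝕂 : Type*) [Field 𝕂] (V W : Type*)
    [AddCommGroup V] [Module 𝕂 V] [AddCommGroup W] [Module 𝕂 W]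
    (A : Submodule 𝕂 V) (B : Submodule 𝕂 W)
    (s : V) (t : W) (hsA : s ∈ A) (hs : s ≠ 0) (htB : t ∈ B) (ht : t ≠ 0)
    (i : V) (k : W) (hi : i ≠ 0) (hk : k ≠ 0) :
    (i ⊗ₜ[𝕂] k ∈
        Submodule.map₂ (TensorProduct.mk 𝕂 V W) A (Submodule.span 𝕂 {t}) ⊔
          Submodule.map₂ (TensorProduct.mk 𝕂 V W) (Submodule.span 𝕂 {s}) B ↔
      (i ∈ Submodule.span 𝕂 ({s} : Set V) ∧ k ∈ B) ∨
        (k ∈ Submodule.span 𝕂 ({t} : Set W) ∧ i ∈ A)) ∧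
    (∀ (I : Submodule 𝕂 V) (K : Submodule 𝕂 W),
      Module.finrank 𝕂 I = 1 → Module.finrank 𝕂 K = 1 →
      (Submodule.map₂ (TensorProduct.mk 𝕂 V W) I K ≤
          Submodule.map₂ (TensorProduct.mk 𝕂 V W) A (Submodule.span 𝕂 {t}) ⊔
            Submodule.map₂ (TensorProduct.mk 𝕂 V W) (Submodule.span 𝕂 {s}) B ↔
        (I = Submodule.span 𝕂 ({s} : Set V) ∧ K ≤ B) ∨
          (K = Submodule.span 𝕂 ({t} : Set W) ∧ I ≤ A))) := by
  refine ⟨Submodule.tmul_mem_map₂_span_singleton_sup_iff hsA htB hi hk, fun I K hI hK => ?_⟩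
  obtain ⟨v, hv, rfl⟩ := Submodule.exists_eq_span_singleton_of_finrank_eq_one hI
  obtain ⟨w, hw, rfl⟩ := Submodule.exists_eq_span_singleton_of_finrank_eq_one hK
  rw [Submodule.map₂_span_span, Set.image2_singleton, Submodule.span_singleton_le_iff_mem,
    Submodule.span_singleton_le_iff_mem, Submodule.span_singleton_le_iff_mem,
    Submodule.span_singleton_eq_span_singleton_iff_mem hv,
    Submodule.span_singleton_eq_span_singleton_iff_mem hw]
  exact Submodule.tmul_mem_map₂_span_singleton_sup_iff hsA htB hv hw

end
end

section
/- Assume d ≥ 3. Then the following are equivalent: (i) there exists a pair q ≠ r in {1,…,d} such that G_{qr} and H_{qr} are linearly dependent over ℝ(x_r); (ii) for every pair q ≠ r in {1,…,d}, G_{qr} and H_{qr} are linearly dependent over ℝ(x_r); (iii) there exist (a,b) ∈ ℝ² ∖ {(0,0)} and a polynomial κ ∈ ℝ[y₁,…,y_n] such that γ = κ · ∏_{i=1}^d (a + b x_i); (iv) there exists q ∈ {1,…,d} (equivalently, for every q ∈ {1,…,d}) such that γ and ∂γ/∂x_q are linearly dependent over ℝ(x_q). -/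
noncomputable section

open MvPolynomial

/-- `γ` is multiaffine: it has degree at most `1` in each variable separately. -/
def MultiAffine {σ : Type*} (γ : MvPolynomial σ ℝ) : Prop :=
  ∀ v : σ, γ.degreeOf v ≤ 1

/-- `γ` is symmetric under all permutations of the variables `x₁,…,x_d`
(the `Sum.inl` variables). -/
def SymmInX (d n : ℕ) (γ : MvPolynomial (Fin d ⊕ Fin n) ℝ) : Prop :=
  ∀ π : Equiv.Perm (Fin d), MvPolynomial.rename (Sum.map (⇑π) id) γ = γ

/-- Substitution `x_q := x_r` in a polynomial of `ℝ[x₁,…,x_d,y₁,…,y_n]`. -/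
def substXX (d n : ℕ) (q r : Fin d) (F : MvPolynomial (Fin d ⊕ Fin n) ℝ) :
    MvPolynomial (Fin d ⊕ Fin n) ℝ :=
  MvPolynomial.rename (fun v => if v = Sum.inl q then Sum.inl r else v) F

/-- `F` and `G` are linearly dependent over `ℝ(z)`: there are `u, v ∈ ℝ[z]`, not both
zero, with `u·F + v·G = 0`. -/
def LinDepOver (d n : ℕ) (z : Fin d ⊕ Fin n)
    (F G : MvPolynomial (Fin d ⊕ Fin n) ℝ) : Prop :=
  ∃ u v : Polynomial ℝ, ¬(u = 0 ∧ v = 0) ∧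
    Polynomial.aeval (MvPolynomial.X z : MvPolynomial (Fin d ⊕ Fin n) ℝ) u * F +
      Polynomial.aeval (MvPolynomial.X z : MvPolynomial (Fin d ⊕ Fin n) ℝ) v * G = 0

open Function in
/-- A polynomial of degree at most one in `v` is affine along the coordinate line of `v`. -/
theorem eval_update_of_degreeOf_le_one {σ : Type*} [DecidableEq σ] {γ : MvPolynomial σ ℝ} {v : σ}
    (h : γ.degreeOf v ≤ 1) (x : σ → ℝ) (t : ℝ) :
    eval (update x v t) γ = eval (update x v 0) γ + t * eval x (pderiv v γ) := by
  rw [γ.as_sum]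
  simp only [map_sum, Finset.mul_sum, ← Finset.sum_add_distrib]
  refine Finset.sum_congr rfl fun s hs => ?_
  have hs1 : s v ≤ 1 := (monomial_le_degreeOf v hs).trans h
  have key (w : ℝ) : eval (update x v w) (monomial s (γ.coeff s)) =
      γ.coeff s * (w ^ s v * (s.erase v).prod fun i k => x i ^ k) := by
    rw [eval_monomial, ← Finsupp.mul_prod_erase' s v _ (by simp)]
    congr 2
    · simp
    · refine Finsupp.prod_congr fun i hi => ?_
      rw [update_of_ne (by aesop)]
  rw [key, key, pderiv_monomial, eval_monomial]
  obtain h0 | h1 : s v = 0 ∨ s v = 1 := by omega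
  · simp [h0]
  · have : s - Finsupp.single v 1 = s.erase v := by
      ext i
      by_cases hi : i = v <;> simp [hi, h1]
    simp [h1, this]
    ring

open Function in
theorem eval_pderiv_of_degreeOf_le_one {σ : Type*} [DecidableEq σ] {γ : MvPolynomial σ ℝ} {v : σ}
    (h : γ.degreeOf v ≤ 1) (x : σ → ℝ) :
    eval x (pderiv v γ) = eval (update x v 1) γ - eval (update x v 0) γ := by
  rw [eval_update_of_degreeOf_le_one h x 1]
  ring

theorem linDepOver_iff {d n : ℕ} {z : Fin d ⊕ Fin n} {F G : MvPolynomial (Fin d ⊕ Fin n) ℝ} :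
    LinDepOver d n z F G ↔ ∃ u v : Polynomial ℝ, ¬(u = 0 ∧ v = 0) ∧
      ∀ x, u.eval (x z) * eval x F + v.eval (x z) * eval x G = 0 := by
  have key (u : Polynomial ℝ) (x : Fin d ⊕ Fin n → ℝ) :
      eval x (Polynomial.aeval (X z : MvPolynomial (Fin d ⊕ Fin n) ℝ) u) = u.eval (x z) := by
    have := Polynomial.hom_eval₂ u (algebraMap ℝ (MvPolynomial (Fin d ⊕ Fin n) ℝ)) (eval x) (X z)
    rw [Polynomial.aeval_def, this, eval_X, Polynomial.eval₂_eq_eval_map]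
    congr 1
    convert Polynomial.map_id
    ext
    simp
  refine exists_congr fun u => exists_congr fun v => and_congr_right fun _ =>
    ⟨fun h x => ?_, fun h => MvPolynomial.funext fun x => ?_⟩
  · simpa [key] using congrArg (eval x) h
  · simpa [key] using h x

open Function in
theorem eval_substXX {d n : ℕ} (q r : Fin d) (F : MvPolynomial (Fin d ⊕ Fin n) ℝ)
    (x : Fin d ⊕ Fin n → ℝ) :
    eval x (substXX d n q r F) = eval (update x (Sum.inl q) (x (Sum.inl r))) F := by
  rw [substXX, eval_rename]
  congr 2
  ext v
  by_cases hv : v = Sum.inl q <;> simp [hv]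

theorem SymmInX.eval_comp {d n : ℕ} {γ : MvPolynomial (Fin d ⊕ Fin n) ℝ} (h : SymmInX d n γ)
    (π : Equiv.Perm (Fin d)) (x : Fin d ⊕ Fin n → ℝ) :
    eval (x ∘ Sum.map π id) γ = eval x γ := by
  rw [← eval_rename, h π]

/-- Two pairs `(P, Q)` satisfying the same nontrivial relation `u P + v Q = 0` are proportional. -/
theorem mul_eq_mul_of_relation {R : Type*} [CommRing R] [IsDomain R] {u v P Q P' Q' : R}
    (huv : ¬(u = 0 ∧ v = 0)) (h : u * P + v * Q = 0) (h' : u * P' + v * Q' = 0) :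
    P * Q' = P' * Q := by
  by_cases hu : u = 0
  · have hv : v ≠ 0 := fun hv => huv ⟨hu, hv⟩
    have hQ : Q = 0 := by simpa [hu, hv] using h
    have hQ' : Q' = 0 := by simpa [hu, hv] using h'
    simp [hQ, hQ']
  · apply mul_left_cancel₀ hu
    linear_combination Q' * h - Q * h'

open Polynomial in
/-- Relations between `A + B t` and `B`, for all members of a family, come from a common one. -/
theorem exists_common_relation_of_affine {Z : Type*} {A B : Z → ℝ} {u v : ℝ[X]}
    (huv : ¬(u = 0 ∧ v = 0))
    (h : ∀ z t, u.eval t * (A z + t * B z) + v.eval t * B z = 0) :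
    ∃ a b : ℝ, (a, b) ≠ (0, 0) ∧ ∀ z, b * A z = a * B z := by
  have hp (z : Z) : u * (.C (A z) + .X * .C (B z)) + v * .C (B z) = 0 :=
    Polynomial.funext fun t => by simpa [mul_comm t] using h z t
  have hc (z w : Z) : A z * B w = A w * B z := by
    have := congrArg (Polynomial.eval 0) (mul_eq_mul_of_relation huv (hp z) (hp w))
    simpa using this
  by_cases h0 : ∃ z, (A z, B z) ≠ (0, 0)
  · obtain ⟨z, hz⟩ := h0
    exact ⟨A z, B z, hz, fun w => by linear_combination hc w z⟩
  · push Not at h0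
    exact ⟨1, 0, by simp, fun z => by simpa using (Prod.ext_iff.1 (h0 z)).2.symm⟩

open Polynomial in
/-- Relations between `A + 2 B t + C t²` and `B + C t`, where `(A, B, C)` are consecutive
coefficients of symmetric multiaffine functions in three variables, come from a common relation. -/
theorem exists_common_relation_of_symmetric {Z : Type*} {f₀ f₁ f₂ f₃ : Z → ℝ} {u v : ℝ[X]}
    (huv : ¬(u = 0 ∧ v = 0))
    (h : ∀ z s t, u.eval t * ((f₀ z + f₁ z * s) + 2 * (f₁ z + f₂ z * s) * t +
        (f₂ z + f₃ z * s) * t ^ 2) +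
      v.eval t * ((f₁ z + f₂ z * s) + (f₂ z + f₃ z * s) * t) = 0) :
    ∃ a b : ℝ, (a, b) ≠ (0, 0) ∧ ∀ z, b * f₀ z = a * f₁ z ∧ b * f₁ z = a * f₂ z ∧
      b * f₂ z = a * f₃ z := by
  set A : Z × ℝ → ℝ := fun z => f₀ z.1 + f₁ z.1 * z.2 with hA
  set B : Z × ℝ → ℝ := fun z => f₁ z.1 + f₂ z.1 * z.2 with hB
  set D : Z × ℝ → ℝ := fun z => f₂ z.1 + f₃ z.1 * z.2 with hD
  have hp (z : Z × ℝ) : u * (.C (A z) + .C (2 * B z) * .X + .C (D z) * .X ^ 2) +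
      v * (.C (B z) + .C (D z) * .X) = 0 :=
    Polynomial.funext fun t => by simpa using h z.1 z.2 t
  have cross (z w : Z × ℝ) (t : ℝ) : (A z + 2 * B z * t + D z * t ^ 2) * (B w + D w * t) =
      (A w + 2 * B w * t + D w * t ^ 2) * (B z + D z * t) := by
    simpa using congrArg (Polynomial.eval t) (mul_eq_mul_of_relation huv (hp z) (hp w))
  have hAB (z w : Z × ℝ) : A z * B w = A w * B z := by simpa using cross z w 0
  have hBD (z w : Z × ℝ) : B z * D w = B w * D z := by
    linear_combination (cross z w 1 + cross z w (-1)) / 2 - hAB z w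
  have hAD (z w : Z × ℝ) : A z * D w = A w * D z := by
    linear_combination (cross z w 1 - cross z w (-1)) / 2
  have hsq (z : Z × ℝ) : A z * D z = B z ^ 2 := by
    have h1 := hAB (z.1, 0) (z.1, 1)
    have h2 := hAD (z.1, 0) (z.1, 1)
    have h3 := hBD (z.1, 0) (z.1, 1)
    simp only [hA, hB, hD] at h1 h2 h3 ⊢
    linear_combination h1 + z.2 * h2 + z.2 ^ 2 * h3
  suffices H : ∃ a b : ℝ, (a, b) ≠ (0, 0) ∧ ∀ z, b * A z = a * B z ∧ b * B z = a * D z by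
    obtain ⟨a, b, hab, H⟩ := H
    refine ⟨a, b, hab, fun z => ?_⟩
    have h0 := H (z, 0)
    have h1 := H (z, 1)
    simp only [hA, hB, hD] at h0 h1
    exact ⟨by linear_combination h0.1, by linear_combination h0.2,
      by linear_combination h1.2 - h0.2⟩
  by_cases hA0 : ∃ z, A z ≠ 0
  · obtain ⟨z, hz⟩ := hA0
    refine ⟨A z, B z, by simp [hz], fun w => ⟨by linear_combination hAB w z, ?_⟩⟩
    apply mul_left_cancel₀ hz
    linear_combination B z * hAB z w - A w * hsq z - A z * hAD z w
  by_cases hD0 : ∃ z, D z ≠ 0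
  · obtain ⟨z, hz⟩ := hD0
    refine ⟨B z, D z, by simp [hz], fun w => ⟨?_, by linear_combination hBD w z⟩⟩
    apply mul_left_cancel₀ hz
    linear_combination D w * hsq z - B z * hBD w z + D z * hAD w z
  push Not at hA0 hD0
  have hB0 (z) : B z = 0 := by simpa [hA0] using (hsq z).symm
  exact ⟨1, 0, by simp, fun z => by simp [hB0, hD0]⟩

/-- A symmetric function of three variables that is affine in the first one. -/
theorem exists_eq_elementary_symmetric {h : ℝ → ℝ → ℝ → ℝ}
    (haff : ∀ a b c, h a b c = h 0 b c + a * (h 1 b c - h 0 b c))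
    (h12 : ∀ a b c, h a b c = h b a c) (h23 : ∀ a b c, h a b c = h a c b) :
    ∃ f₀ f₁ f₂ f₃ : ℝ, ∀ a b c, h a b c =
      f₀ + f₁ * (a + b + c) + f₂ * (a * b + b * c + c * a) + f₃ * (a * b * c) := by
  refine ⟨h 0 0 0, h 1 0 0 - h 0 0 0, h 1 1 0 - 2 * h 1 0 0 + h 0 0 0,
    h 1 1 1 - 3 * h 1 1 0 + 3 * h 1 0 0 - h 0 0 0, fun a b c => ?_⟩
  have hb (a b c) : h a b c = h a 0 c + b * (h a 1 c - h a 0 c) := by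
    rw [h12, haff, h12 0 a, h12 1 a]
  have hc (a b c) : h a b c = h a b 0 + c * (h a b 1 - h a b 0) := by
    rw [h23, hb, h23 a 0, h23 a 1]
  rw [haff, hb 0 b c, hb 1 b c, hc 0 0 c, hc 1 0 c, hc 0 1 c, hc 1 1 c, h12 0 1 1, h23 1 0 1,
    h12 0 1 0, h23 0 0 1, h12 0 1 0]
  ring

section Ratio

open Function

variable {d n : ℕ} {γ : MvPolynomial (Fin d ⊕ Fin n) ℝ}

/-- Along the `q`-th coordinate, `γ` is proportional to `a + b x_q`. -/
def HasRatio (γ : MvPolynomial (Fin d ⊕ Fin n) ℝ) (a b : ℝ) (q : Fin d) : Prop :=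
  ∀ x : Fin d ⊕ Fin n → ℝ, b * eval (update x (Sum.inl q) 0) γ = a * eval x (pderiv (Sum.inl q) γ)

theorem update_comp_map_swap (x : Fin d ⊕ Fin n → ℝ) (q r : Fin d) (t : ℝ) :
    update (x ∘ Sum.map (Equiv.swap q r) id) (Sum.inl r) t =
      update x (Sum.inl q) t ∘ Sum.map (Equiv.swap q r) id := by
  ext (i | j)
  · by_cases hr : i = r
    · simp [hr]
    · have : Equiv.swap q r i ≠ q := fun h => hr (by simpa using congrArg (Equiv.swap q r) h)
      simp [hr, this]
  · simp

theorem HasRatio.of_symmInX {a b : ℝ} {q : Fin d} (h : HasRatio γ a b q) (hma : MultiAffine γ)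
    (hsym : SymmInX d n γ) (r : Fin d) : HasRatio γ a b r := by
  intro x
  have key (t : ℝ) : eval (update x (Sum.inl r) t) γ =
      eval (update (x ∘ Sum.map (Equiv.swap r q) id) (Sum.inl q) t) γ := by
    rw [update_comp_map_swap, hsym.eval_comp]
  have := h (x ∘ Sum.map (Equiv.swap r q) id)
  rw [eval_pderiv_of_degreeOf_le_one (hma _)] at this ⊢
  simpa only [key] using this

theorem HasRatio.mul_eval {a b : ℝ} {q : Fin d} (h : HasRatio γ a b q) (hma : MultiAffine γ)
    (x : Fin d ⊕ Fin n → ℝ) :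
    b * eval x γ = (a + b * x (Sum.inl q)) * eval x (pderiv (Sum.inl q) γ) := by
  have h1 := eval_update_of_degreeOf_le_one (hma (Sum.inl q)) x (x (Sum.inl q))
  rw [update_eq_self] at h1
  linear_combination b * h1 + h x

theorem HasRatio.linDepOver {a b : ℝ} {q : Fin d} (h : HasRatio γ a b q) (hma : MultiAffine γ)
    (hab : (a, b) ≠ (0, 0)) :
    LinDepOver d n (Sum.inl q) γ (pderiv (Sum.inl q) γ) := by
  refine linDepOver_iff.2 ⟨.C b, -(.C a + .C b * .X), ?_, fun x => ?_⟩
  · rintro ⟨hb, h0⟩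
    have hb' : b = 0 := by simpa using hb
    subst hb'
    simp_all
  · simp only [Polynomial.eval_C, Polynomial.eval_neg, Polynomial.eval_add, Polynomial.eval_mul,
      Polynomial.eval_X]
    linear_combination h.mul_eval hma x

theorem HasRatio.linDepOver_substXX {a b : ℝ} {q : Fin d} (h : HasRatio γ a b q)
    (hma : MultiAffine γ) (hab : (a, b) ≠ (0, 0)) (r : Fin d) :
    LinDepOver d n (Sum.inl r) (substXX d n q r γ) (substXX d n q r (pderiv (Sum.inl q) γ)) := by
  refine linDepOver_iff.2 ⟨.C b, -(.C a + .C b * .X), ?_, fun x => ?_⟩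
  · rintro ⟨hb, h0⟩
    have hb' : b = 0 := by simpa using hb
    subst hb'
    simp_all
  · have := h.mul_eval hma (update x (Sum.inl q) (x (Sum.inl r)))
    rw [update_self] at this
    simp only [Polynomial.eval_C, Polynomial.eval_neg, Polynomial.eval_add, Polynomial.eval_mul,
      Polynomial.eval_X, eval_substXX]
    linear_combination this

theorem exists_hasRatio_of_linDepOver {q : Fin d} (hma : MultiAffine γ)
    (h : LinDepOver d n (Sum.inl q) γ (pderiv (Sum.inl q) γ)) :
    ∃ a b : ℝ, (a, b) ≠ (0, 0) ∧ HasRatio γ a b q := by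
  obtain ⟨u, v, huv, h⟩ := linDepOver_iff.1 h
  refine exists_common_relation_of_affine huv fun x t => ?_
  have := h (update x (Sum.inl q) t)
  rw [update_self, eval_update_of_degreeOf_le_one (hma _)] at this
  simpa [eval_pderiv_of_degreeOf_le_one (hma _)] using this

theorem exists_hasRatio_of_linDepOver_substXX (hd : 3 ≤ d) {q r : Fin d} (hqr : q ≠ r)
    (hma : MultiAffine γ) (hsym : SymmInX d n γ)
    (h : LinDepOver d n (Sum.inl r) (substXX d n q r γ)
      (substXX d n q r (pderiv (Sum.inl q) γ))) :
    ∃ a b : ℝ, (a, b) ≠ (0, 0) ∧ HasRatio γ a b q := by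
  obtain ⟨u, v, huv, h⟩ := linDepOver_iff.1 h
  obtain ⟨s, hsq, hsr⟩ : ∃ s, s ≠ q ∧ s ≠ r := by
    have : ({q, r} : Finset (Fin d)).card < Fintype.card (Fin d) := by
      rw [Fintype.card_fin]
      exact Finset.card_le_two.trans_lt hd
    obtain ⟨s, hs⟩ := Finset.exists_mem_notMem_of_card_lt_card (t := Finset.univ) this
    exact ⟨s, by simpa using hs⟩
  let P (x : Fin d ⊕ Fin n → ℝ) (a b c : ℝ) : Fin d ⊕ Fin n → ℝ :=
    update (update (update x (Sum.inl s) c) (Sum.inl r) b) (Sum.inl q) a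
  have hP1 (x a b c t) : update (P x a b c) (Sum.inl q) t = P x t b c := by simp [P]
  have h12 (x a b c) : eval (P x a b c) γ = eval (P x b a c) γ := by
    rw [← hsym.eval_comp (Equiv.swap q r) (P x a b c)]
    congr 2
    ext (i | j)
    · rcases eq_or_ne i q with rfl | hq
      · simp [P, hqr.symm]
      rcases eq_or_ne i r with rfl | hr
      · simp [P, hqr.symm]
      simp [P, hq, hr, Equiv.swap_apply_of_ne_of_ne, Function.update_apply]
    · simp [P]
  have h23 (x a b c) : eval (P x a b c) γ = eval (P x a c b) γ := by
    rw [← hsym.eval_comp (Equiv.swap r s) (P x a b c)]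
    congr 2
    ext (i | j)
    · rcases eq_or_ne i q with rfl | hq
      · simp [P, hqr, hsq.symm, Equiv.swap_apply_of_ne_of_ne]
      rcases eq_or_ne i r with rfl | hr
      · simp [P, hsq, hsr, hqr.symm]
      rcases eq_or_ne i s with rfl | hs
      · simp [P, hsq, hsr, hqr.symm]
      simp [P, hq, hr, hs, Equiv.swap_apply_of_ne_of_ne]
    · simp [P]
  have haff (x a b c) : eval (P x a b c) γ =
      eval (P x 0 b c) γ + a * (eval (P x 1 b c) γ - eval (P x 0 b c) γ) := by
    have := eval_update_of_degreeOf_le_one (hma (Sum.inl q)) (P x a b c) a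
    rwa [eval_pderiv_of_degreeOf_le_one (hma _), hP1, hP1, hP1] at this
  choose f₀ f₁ f₂ f₃ hf using fun x => exists_eq_elementary_symmetric (haff x) (h12 x) (h23 x)
  obtain ⟨a, b, hab, H⟩ := exists_common_relation_of_symmetric (f₀ := f₀) (f₁ := f₁) (f₂ := f₂)
      (f₃ := f₃) huv fun x c t => by
    have hr : P x 0 t c (Sum.inl r) = t := by simp [P, hqr.symm]
    have := h (P x 0 t c)
    rw [eval_substXX, eval_substXX, eval_pderiv_of_degreeOf_le_one (hma _), hr, hP1, hP1, hP1, hf,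
      hf, hf] at this
    linear_combination this
  refine ⟨a, b, hab, fun x => ?_⟩
  obtain ⟨h0, h1, h2⟩ := H x
  have hx (t : ℝ) : update x (Sum.inl q) t = P x t (x (Sum.inl r)) (x (Sum.inl s)) := by
    simp [P]
  rw [eval_pderiv_of_degreeOf_le_one (hma _), hx, hx, hf, hf]
  linear_combination h0 + (x (Sum.inl r) + x (Sum.inl s)) * h1 +
    x (Sum.inl r) * x (Sum.inl s) * h2

theorem HasRatio.eval_mul_pow {a b c : ℝ} (h : ∀ q, HasRatio γ a b q) (hma : MultiAffine γ)
    (x : Fin d ⊕ Fin n → ℝ) (S : Finset (Fin d)) :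
    eval x γ * (a + b * c) ^ S.card =
      eval (Sum.elim (fun i => if i ∈ S then c else x (Sum.inl i)) (x ∘ Sum.inr)) γ *
        ∏ i ∈ S, (a + b * x (Sum.inl i)) := by
  induction S using Finset.induction_on with
  | empty =>
    have hx : Sum.elim (fun i => x (Sum.inl i)) (x ∘ Sum.inr) = x := Sum.elim_comp_inl_inr x
    simp [hx]
  | insert q S hq ih =>
    set z := Sum.elim (fun i => if i ∈ S then c else x (Sum.inl i)) (x ∘ Sum.inr) with hz
    have hzq : z (Sum.inl q) = x (Sum.inl q) := by simp [hz, hq]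
    have hup : Sum.elim (fun i => if i ∈ insert q S then c else x (Sum.inl i)) (x ∘ Sum.inr) =
        update z (Sum.inl q) c := by
      ext (i | j)
      · by_cases hi : i = q <;> simp [hz, hi]
      · simp [hz]
    have h1 := eval_update_of_degreeOf_le_one (hma (Sum.inl q)) z (z (Sum.inl q))
    rw [update_eq_self, hzq] at h1
    rw [Finset.card_insert_of_notMem hq, Finset.prod_insert hq, hup,
      eval_update_of_degreeOf_le_one (hma _), pow_succ, ← mul_assoc, ih]
    linear_combination (∏ i ∈ S, (a + b * x (Sum.inl i))) *
      ((a + b * c) * h1 + (c - x (Sum.inl q)) * h q z)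

theorem exists_eq_mul_prod_of_hasRatio {a b : ℝ} (hab : (a, b) ≠ (0, 0))
    (h : ∀ q, HasRatio γ a b q) (hma : MultiAffine γ) :
    ∃ κ : MvPolynomial (Fin n) ℝ,
      γ = rename Sum.inr κ * ∏ i : Fin d, (C a + C b * X (Sum.inl i)) := by
  obtain ⟨c, hc⟩ : ∃ c : ℝ, a + b * c ≠ 0 := by
    by_cases ha : a = 0
    · exact ⟨1, by simpa [ha] using hab⟩
    · exact ⟨0, by simpa using ha⟩
  refine ⟨C ((a + b * c) ^ d)⁻¹ * bind₁ (Sum.elim (fun _ => C c) X) γ,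
    MvPolynomial.funext fun x => ?_⟩
  have key := HasRatio.eval_mul_pow (c := c) h hma x Finset.univ
  have hev (F : MvPolynomial (Fin d ⊕ Fin n) ℝ) :
      eval (x ∘ Sum.inr) (bind₁ (Sum.elim (fun _ => C c) X) F) =
        eval (Sum.elim (fun _ => c) (x ∘ Sum.inr)) F := by
    induction F using MvPolynomial.induction_on with
    | C r => simp
    | add p q hp hq => simp [hp, hq]
    | mul_X p v hp => rcases v with i | j <;> simp [hp]
  simp only [Finset.mem_univ, if_true, Finset.card_univ, Fintype.card_fin] at key
  rw [map_mul, eval_rename, map_mul, hev, eval_C, mul_assoc, map_prod]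
  simp only [map_add, map_mul, eval_C, eval_X]
  rw [← key]
  field_simp

theorem hasRatio_of_eq_mul_prod {a b : ℝ} {κ : MvPolynomial (Fin n) ℝ} (hma : MultiAffine γ)
    (h : γ = rename Sum.inr κ * ∏ i : Fin d, (C a + C b * X (Sum.inl i))) (q : Fin d) :
    HasRatio γ a b q := by
  intro x
  have key (t : ℝ) : eval (update x (Sum.inl q) t) γ = (a + b * t) *
      (eval (x ∘ Sum.inr) κ * ∏ i ∈ Finset.univ.erase q, (a + b * x (Sum.inl i))) := by
    rw [h, map_mul, eval_rename, map_prod, ← Finset.mul_prod_erase _ _ (Finset.mem_univ q)]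
    have hprod : ∏ i ∈ Finset.univ.erase q, eval (update x (Sum.inl q) t)
        (C a + C b * X (Sum.inl i)) = ∏ i ∈ Finset.univ.erase q, (a + b * x (Sum.inl i)) :=
      Finset.prod_congr rfl fun i hi => by simp [Finset.ne_of_mem_erase hi]
    have hy : update x (Sum.inl q) t ∘ Sum.inr = x ∘ Sum.inr := by ext j; simp
    rw [hprod, hy]
    simp
    ring
  rw [eval_pderiv_of_degreeOf_le_one (hma _), key, key]
  ring

end Ratio

/-- for `d ≥ 3` and `γ ∈ ℝ[x₁,…,x_d,y₁,…,y_n]` multiaffine and symmetric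
in `x₁,…,x_d`, the following are equivalent: (i) for some pair `q ≠ r` the polynomials
`G_{qr}` (i.e. `γ` with `x_q := x_r`) and `H_{qr}` (i.e. `∂γ/∂x_q` with `x_q := x_r`)
are linearly dependent over `ℝ(x_r)`; (ii) the same holds for every pair `q ≠ r`;
(iii) `γ = κ · ∏_{i=1}^d (a + b x_i)` for some `(a,b) ≠ (0,0)` and `κ ∈ ℝ[y₁,…,y_n]`;
(iv) for some `q` (equivalently, for every `q`) `γ` and `∂γ/∂x_q` are linearly dependent
over `ℝ(x_q)`. -/
theorem statement10 (d n : ℕ) (hd : 3 ≤ d)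
    (γ : MvPolynomial (Fin d ⊕ Fin n) ℝ)
    (hma : MultiAffine γ) (hsym : SymmInX d n γ) :
    List.TFAE
      [ ∃ q r : Fin d, q ≠ r ∧
          LinDepOver d n (Sum.inl r) (substXX d n q r γ)
            (substXX d n q r (MvPolynomial.pderiv (Sum.inl q) γ)),
        ∀ q r : Fin d, q ≠ r →
          LinDepOver d n (Sum.inl r) (substXX d n q r γ)
            (substXX d n q r (MvPolynomial.pderiv (Sum.inl q) γ)),
        ∃ a b : ℝ, (a, b) ≠ (0, 0) ∧ ∃ κ : MvPolynomial (Fin n) ℝ,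
          γ = MvPolynomial.rename Sum.inr κ *
            ∏ i : Fin d, (MvPolynomial.C a + MvPolynomial.C b * MvPolynomial.X (Sum.inl i)),
        ∃ q : Fin d, LinDepOver d n (Sum.inl q) γ (MvPolynomial.pderiv (Sum.inl q) γ),
        ∀ q : Fin d, LinDepOver d n (Sum.inl q) γ (MvPolynomial.pderiv (Sum.inl q) γ) ] := by
  tfae_have 1 → 3 := by
    rintro ⟨q, r, hqr, h⟩
    obtain ⟨a, b, hab, h⟩ := exists_hasRatio_of_linDepOver_substXX hd hqr hma hsym h
    exact ⟨a, b, hab, exists_eq_mul_prod_of_hasRatio hab (h.of_symmInX hma hsym) hma⟩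
  tfae_have 4 → 3 := by
    rintro ⟨q, h⟩
    obtain ⟨a, b, hab, h⟩ := exists_hasRatio_of_linDepOver hma h
    exact ⟨a, b, hab, exists_eq_mul_prod_of_hasRatio hab (h.of_symmInX hma hsym) hma⟩
  tfae_have 3 → 2 := by
    rintro ⟨a, b, hab, κ, h⟩ q r -
    exact (hasRatio_of_eq_mul_prod hma h q).linDepOver_substXX hma hab r
  tfae_have 3 → 5 := by
    rintro ⟨a, b, hab, κ, h⟩ q
    exact (hasRatio_of_eq_mul_prod hma h q).linDepOver hma hab
  tfae_have 2 → 1 := fun h =>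
    ⟨⟨0, by omega⟩, ⟨1, by omega⟩, by simp, h _ _ (by simp)⟩
  tfae_have 5 → 4 := fun h => ⟨⟨0, by omega⟩, h _⟩
  tfae_finish

end
end

section
/- Assume d = 2, so γ = α₀ + α₁(x₁+x₂) + α₂ x₁x₂ with α₀, α₁, α₂ ∈ ℝ[y₁,…,y_n]. Then: (a) G_{12} and H_{12} are linearly dependent over ℝ(x₂) if and only if there exist a, b, c ∈ ℝ and κ ∈ ℝ[y₁,…,y_n] with γ = κ · (a + b(x₁+x₂) + c x₁x₂); and (b) γ and ∂γ/∂x₁ are linearly dependent over ℝ(x₁) if and only if there exist a, b ∈ ℝ, not both zero, and κ ∈ ℝ[y₁,…,y_n] with γ = κ · (a + b x₁)(a + b x₂). -/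
noncomputable section

open MvPolynomial

/-- Polynomials whose pairwise `2 × 2` minors of values vanish are scalar multiples of one
polynomial, with scalars given by their values at some point. -/
theorem forall_eq_zero_or_exists_common_factor {σ ι : Type*} (α : ι → MvPolynomial σ ℝ)
    (h : ∀ i j y y', eval y (α i) * eval y' (α j) = eval y' (α i) * eval y (α j)) :
    (∀ i, α i = 0) ∨
      ∃ y κ, (∃ i, eval y (α i) ≠ 0) ∧ ∀ i, α i = κ * C (eval y (α i)) := by
  by_cases h0 : ∃ i y, eval y (α i) ≠ 0
  · obtain ⟨i, y, hi⟩ := h0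
    refine Or.inr ⟨y, C (eval y (α i))⁻¹ * α i, ⟨i, hi⟩, fun j => MvPolynomial.funext fun z => ?_⟩
    have := h i j y z
    simp only [map_mul, eval_C]
    field_simp
    linarith
  · push Not at h0
    exact Or.inl fun i => MvPolynomial.funext fun y => by simpa using h0 i y

theorem pderiv_inl_rename_inr {σ τ : Type*} (i : σ) (p : MvPolynomial τ ℝ) :
    pderiv (Sum.inl i) (rename (Sum.inr : τ → σ ⊕ τ) p) = 0 := by
  induction p using MvPolynomial.induction_on with
  | C a => simp
  | add p q hp hq => simp [hp, hq]
  | mul_X p j hp => simp [hp]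

/-- The polynomial `α₀ + α₁(x₁ + x₂) + α₂x₁x₂`. -/
def symmBiaffine {n : ℕ} (α₀ α₁ α₂ : MvPolynomial (Fin n) ℝ) :
    MvPolynomial (Fin 2 ⊕ Fin n) ℝ :=
  rename Sum.inr α₀ + rename Sum.inr α₁ * (X (Sum.inl 0) + X (Sum.inl 1)) +
    rename Sum.inr α₂ * (X (Sum.inl 0) * X (Sum.inl 1))

theorem MultiAffine.exists_eq {n : ℕ} {γ : MvPolynomial (Fin 2 ⊕ Fin n) ℝ}
    (hma : MultiAffine γ) : ∃ α β β' δ : MvPolynomial (Fin n) ℝ,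
      γ = rename Sum.inr α + rename Sum.inr β * X (Sum.inl 0) +
        rename Sum.inr β' * X (Sum.inl 1) +
        rename Sum.inr δ * (X (Sum.inl 0) * X (Sum.inl 1)) := by
  rw [γ.as_sum]
  refine Finset.sum_induction _ (fun γ => ∃ α β β' δ : MvPolynomial (Fin n) ℝ,
      γ = rename Sum.inr α + rename Sum.inr β * X (Sum.inl 0) +
        rename Sum.inr β' * X (Sum.inl 1) +
        rename Sum.inr δ * (X (Sum.inl 0) * X (Sum.inl 1))) ?_ ?_ ?_
  · rintro _ _ ⟨α, β, β', δ, rfl⟩ ⟨α₂, β₂, β₂', δ₂, rfl⟩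
    refine ⟨α + α₂, β + β₂, β' + β₂', δ + δ₂, ?_⟩
    simp only [map_add]
    ring
  · exact ⟨0, 0, 0, 0, by simp⟩
  · intro m hm
    have h0 : m (Sum.inl 0) ≤ 1 := (monomial_le_degreeOf _ hm).trans (hma _)
    have h1 : m (Sum.inl 1) ≤ 1 := (monomial_le_degreeOf _ hm).trans (hma _)
    have key : monomial m (coeff m γ) =
        rename Sum.inr (C (coeff m γ) * ∏ j, X j ^ m (Sum.inr j)) *
          (X (Sum.inl 0) ^ m (Sum.inl 0) * X (Sum.inl 1) ^ m (Sum.inl 1)) := by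
      rw [monomial_eq, Finsupp.prod_fintype _ _ (by simp), Fintype.prod_sum_type]
      simp only [Fin.prod_univ_two, map_mul, map_prod, map_pow, rename_X, rename_C]
      ring
    rw [key]
    generalize C (coeff m γ) * ∏ j, X j ^ m (Sum.inr j) = p
    interval_cases m (Sum.inl 0) <;> interval_cases m (Sum.inl 1)
    · exact ⟨p, 0, 0, 0, by simp⟩
    · exact ⟨0, 0, p, 0, by simp⟩
    · exact ⟨0, p, 0, 0, by simp⟩
    · exact ⟨0, 0, 0, p, by simp⟩

theorem MultiAffine.exists_eq_symmBiaffine {n : ℕ} {γ : MvPolynomial (Fin 2 ⊕ Fin n) ℝ}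
    (hma : MultiAffine γ) (hsym : SymmInX 2 n γ) :
    ∃ α₀ α₁ α₂ : MvPolynomial (Fin n) ℝ, γ = symmBiaffine α₀ α₁ α₂ := by
  obtain ⟨α, β, β', δ, rfl⟩ := hma.exists_eq
  have hinr : Sum.map (Equiv.swap (0 : Fin 2) 1) id ∘ Sum.inr = (Sum.inr : Fin n → _) := rfl
  have hswap := hsym (Equiv.swap 0 1)
  simp only [map_add, map_mul, rename_rename, rename_X, hinr, Sum.map_inl,
    Equiv.swap_apply_left, Equiv.swap_apply_right] at hswap
  have hX : (X (Sum.inl 1) - X (Sum.inl 0) : MvPolynomial (Fin 2 ⊕ Fin n) ℝ) ≠ 0 :=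
    sub_ne_zero.2 fun h => by simpa using X_injective h
  have hmul : (rename Sum.inr β - rename Sum.inr β') *
      (X (Sum.inl 1) - X (Sum.inl 0) : MvPolynomial (Fin 2 ⊕ Fin n) ℝ) = 0 := by
    linear_combination hswap
  obtain rfl : β = β' := rename_injective _ Sum.inr_injective
    (sub_eq_zero.1 ((mul_eq_zero.1 hmul).resolve_right hX))
  exact ⟨α, β, δ, by rw [symmBiaffine]; ring⟩

theorem pderiv_symmBiaffine {n : ℕ} (α₀ α₁ α₂ : MvPolynomial (Fin n) ℝ) :
    pderiv (Sum.inl 0) (symmBiaffine α₀ α₁ α₂) =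
      rename Sum.inr α₁ + rename Sum.inr α₂ * X (Sum.inl 1) := by
  simp [symmBiaffine, pderiv_inl_rename_inr, pderiv_X]

theorem substXX_rename_inr {n : ℕ} (p : MvPolynomial (Fin n) ℝ) :
    substXX 2 n 0 1 (rename Sum.inr p) = rename Sum.inr p := by
  rw [substXX, rename_rename]
  congr 1

theorem substXX_symmBiaffine {n : ℕ} (α₀ α₁ α₂ : MvPolynomial (Fin n) ℝ) :
    substXX 2 n 0 1 (symmBiaffine α₀ α₁ α₂) =
      rename Sum.inr α₀ + rename Sum.inr α₁ * (X (Sum.inl 1) + X (Sum.inl 1)) +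
        rename Sum.inr α₂ * (X (Sum.inl 1) * X (Sum.inl 1)) := by
  have h := substXX_rename_inr (n := n)
  simp only [substXX] at h
  simp [symmBiaffine, substXX, h]

theorem substXX_pderiv_symmBiaffine {n : ℕ} (α₀ α₁ α₂ : MvPolynomial (Fin n) ℝ) :
    substXX 2 n 0 1 (pderiv (Sum.inl 0) (symmBiaffine α₀ α₁ α₂)) =
      rename Sum.inr α₁ + rename Sum.inr α₂ * X (Sum.inl 1) := by
  have h := substXX_rename_inr (n := n)
  simp only [substXX] at h
  simp [pderiv_symmBiaffine, substXX, h]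

theorem symmBiaffine_mul_C {n : ℕ} (κ : MvPolynomial (Fin n) ℝ) (a b c : ℝ) :
    symmBiaffine (κ * C a) (κ * C b) (κ * C c) = rename Sum.inr κ *
      (C a + C b * (X (Sum.inl 0) + X (Sum.inl 1)) + C c * (X (Sum.inl 0) * X (Sum.inl 1))) := by
  simp only [symmBiaffine, map_mul, rename_C]
  ring

theorem aeval_C_comp_rename_inr {σ τ : Type*} (f : σ → Polynomial ℝ) (y : τ → ℝ)
    (p : MvPolynomial τ ℝ) :
    aeval (Sum.elim f fun j => Polynomial.C (y j)) (rename Sum.inr p) =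
      Polynomial.C (eval y p) := by
  rw [aeval_rename, Sum.elim_comp_inr]
  induction p using MvPolynomial.induction_on with
  | C a => simp [Polynomial.algebraMap_eq]
  | add p q hp hq => simp [hp, hq]
  | mul_X p j hp => simp [hp]

/-- Two specialisations of a dependent pair to `ℝ[z]` fixing `z` have vanishing determinant. -/
theorem LinDepOver.aeval_mul_eq {d n : ℕ} {z : Fin d ⊕ Fin n}
    {F G : MvPolynomial (Fin d ⊕ Fin n) ℝ} (h : LinDepOver d n z F G)
    {f g : Fin d ⊕ Fin n → Polynomial ℝ} (hf : f z = Polynomial.X) (hg : g z = Polynomial.X) :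
    aeval f F * aeval g G = aeval g F * aeval f G := by
  obtain ⟨u, v, huv, h⟩ := h
  have hspec : ∀ f : Fin d ⊕ Fin n → Polynomial ℝ, f z = Polynomial.X →
      u * aeval f F + v * aeval f G = 0 := fun f hf => by
    simpa [← Polynomial.aeval_algHom_apply, hf] using congrArg (aeval f) h
  have h1 := hspec f hf
  have h2 := hspec g hg
  have hu : u * (aeval f F * aeval g G - aeval g F * aeval f G) = 0 := by
    linear_combination aeval g G * h1 - aeval f G * h2
  have hv : v * (aeval f F * aeval g G - aeval g F * aeval f G) = 0 := by
    linear_combination aeval f F * h2 - aeval g F * h1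
  rcases not_and_or.1 huv with hne | hne
  · exact sub_eq_zero.1 ((mul_eq_zero.1 hu).resolve_left hne)
  · exact sub_eq_zero.1 ((mul_eq_zero.1 hv).resolve_left hne)

/-- Restatement of `forall_eq_zero_or_exists_common_factor` for three polynomials. -/
theorem symmBiaffine_eq_zero_or_exists {n : ℕ} (α₀ α₁ α₂ : MvPolynomial (Fin n) ℝ)
    (h01 : ∀ y y', eval y α₀ * eval y' α₁ = eval y' α₀ * eval y α₁)
    (h02 : ∀ y y', eval y α₀ * eval y' α₂ = eval y' α₀ * eval y α₂)
    (h12 : ∀ y y', eval y α₁ * eval y' α₂ = eval y' α₁ * eval y α₂) :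
    symmBiaffine α₀ α₁ α₂ = 0 ∨ ∃ y κ,
      (eval y α₀ ≠ 0 ∨ eval y α₁ ≠ 0 ∨ eval y α₂ ≠ 0) ∧
      symmBiaffine α₀ α₁ α₂ = symmBiaffine (κ * C (eval y α₀)) (κ * C (eval y α₁))
        (κ * C (eval y α₂)) := by
  have hminor : ∀ i j y y', eval y (![α₀, α₁, α₂] i) * eval y' (![α₀, α₁, α₂] j) =
      eval y' (![α₀, α₁, α₂] i) * eval y (![α₀, α₁, α₂] j) := by
    intro i j y y'
    have := h01 y y'
    have := h02 y y'
    have := h12 y y'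
    fin_cases i <;> fin_cases j <;> simp <;> linarith
  rcases forall_eq_zero_or_exists_common_factor _ hminor with h | ⟨y, κ, hne, h⟩
  · left
    have h0 : α₀ = 0 := h 0
    have h1 : α₁ = 0 := h 1
    have h2 : α₂ = 0 := h 2
    simp [symmBiaffine, h0, h1, h2]
  · refine Or.inr ⟨y, κ, by simpa [Fin.exists_fin_succ] using hne, ?_⟩
    have h0 : α₀ = κ * C (eval y α₀) := h 0
    have h1 : α₁ = κ * C (eval y α₁) := h 1
    have h2 : α₂ = κ * C (eval y α₂) := h 2
    rw [← h0, ← h1, ← h2]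

/-- The minors of the values of the coefficients, from dependence on the diagonal `x₁ = x₂`. -/
theorem minors_of_linDepOver_substXX {n : ℕ} {α₀ α₁ α₂ : MvPolynomial (Fin n) ℝ}
    (h : LinDepOver 2 n (Sum.inl 1) (substXX 2 n 0 1 (symmBiaffine α₀ α₁ α₂))
      (substXX 2 n 0 1 (pderiv (Sum.inl 0) (symmBiaffine α₀ α₁ α₂)))) (y y' : Fin n → ℝ) :
    eval y α₀ * eval y' α₁ = eval y' α₀ * eval y α₁ ∧
    eval y α₀ * eval y' α₂ = eval y' α₀ * eval y α₂ ∧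
    eval y α₁ * eval y' α₂ = eval y' α₁ * eval y α₂ := by
  rw [substXX_symmBiaffine, substXX_pderiv_symmBiaffine] at h
  have key := h.aeval_mul_eq
    (f := Sum.elim (fun _ => Polynomial.X) fun j => Polynomial.C (y j))
    (g := Sum.elim (fun _ => Polynomial.X) fun j => Polynomial.C (y' j)) rfl rfl
  simp only [map_add, map_mul, aeval_C_comp_rename_inr, aeval_X, Sum.elim_inl] at key
  have heval := fun t : ℝ => congrArg (Polynomial.eval t) key
  simp only [Polynomial.eval_add, Polynomial.eval_mul, Polynomial.eval_C,
    Polynomial.eval_X] at heval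
  have e0 := heval 0
  have e1 := heval 1
  have e2 := heval (-1)
  have e3 := heval 2
  refine ⟨?_, ?_, ?_⟩ <;> linarith

/-- The minors of the values of the coefficients, from dependence over `ℝ(x₁)`. -/
theorem minors_of_linDepOver_pderiv {n : ℕ} {α₀ α₁ α₂ : MvPolynomial (Fin n) ℝ}
    (h : LinDepOver 2 n (Sum.inl 0) (symmBiaffine α₀ α₁ α₂)
      (pderiv (Sum.inl 0) (symmBiaffine α₀ α₁ α₂))) (y y' : Fin n → ℝ) :
    eval y α₀ * eval y' α₁ = eval y' α₀ * eval y α₁ ∧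
    eval y α₀ * eval y' α₂ = eval y α₁ * eval y' α₁ ∧
    eval y α₁ * eval y' α₂ = eval y' α₁ * eval y α₂ := by
  rw [pderiv_symmBiaffine, symmBiaffine] at h
  have heval := fun s s' t : ℝ => congrArg (Polynomial.eval t) <| h.aeval_mul_eq
    (f := Sum.elim ![Polynomial.X, Polynomial.C s] fun j => Polynomial.C (y j))
    (g := Sum.elim ![Polynomial.X, Polynomial.C s'] fun j => Polynomial.C (y' j)) rfl rfl
  simp only [map_add, map_mul, aeval_C_comp_rename_inr, aeval_X, Sum.elim_inl,
    Matrix.cons_val_zero, Matrix.cons_val_one, Polynomial.eval_add, Polynomial.eval_mul,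
    Polynomial.eval_C, Polynomial.eval_X] at heval
  have e00 := heval 0 0 0
  have e10 := heval 1 0 0
  have e01 := heval 0 1 0
  have e11 := heval 1 1 0
  refine ⟨?_, ?_, ?_⟩ <;> linarith

theorem linDepOver_substXX_mul_C {n : ℕ} (κ : MvPolynomial (Fin n) ℝ) (a b c : ℝ) :
    LinDepOver 2 n (Sum.inl 1) (substXX 2 n 0 1 (symmBiaffine (κ * C a) (κ * C b) (κ * C c)))
      (substXX 2 n 0 1
        (pderiv (Sum.inl 0) (symmBiaffine (κ * C a) (κ * C b) (κ * C c)))) := by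
  rw [substXX_symmBiaffine, substXX_pderiv_symmBiaffine]
  by_cases h : a = 0 ∧ b = 0 ∧ c = 0
  · obtain ⟨rfl, rfl, rfl⟩ := h
    exact ⟨1, 0, by simp, by simp⟩
  · refine ⟨Polynomial.C b + Polynomial.C c * Polynomial.X,
      -(Polynomial.C a + Polynomial.C (2 * b) * Polynomial.X +
        Polynomial.C c * Polynomial.X ^ 2), ?_, ?_⟩
    · rintro ⟨hu, hv⟩
      refine h ⟨?_, ?_, ?_⟩
      · simpa using congrArg (Polynomial.eval 0) hv
      · simpa using congrArg (Polynomial.eval 0) hu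
      · simpa using congrArg (Polynomial.coeff · 1) hu
    · simp only [map_add, map_mul, map_neg, map_pow, rename_C, Polynomial.aeval_C,
        Polynomial.aeval_X, algebraMap_eq, map_ofNat]
      ring

theorem linDepOver_pderiv_mul {n : ℕ} (κ : MvPolynomial (Fin n) ℝ) {a b : ℝ}
    (hab : (a, b) ≠ (0, 0)) :
    LinDepOver 2 n (Sum.inl 0)
      (rename Sum.inr κ *
        ((C a + C b * X (Sum.inl 0)) * (C a + C b * X (Sum.inl 1))))
      (pderiv (Sum.inl 0) (rename Sum.inr κ *
        ((C a + C b * X (Sum.inl 0)) * (C a + C b * X (Sum.inl 1))))) := by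
  refine ⟨Polynomial.C b, -(Polynomial.C a + Polynomial.C b * Polynomial.X), ?_, ?_⟩
  · rintro ⟨hu, hv⟩
    obtain rfl : b = 0 := by simpa using hu
    obtain rfl : a = 0 := by simpa using hv
    exact hab rfl
  · simp [pderiv_inl_rename_inr, pderiv_X, algebraMap_eq]
    ring

theorem exists_symmBiaffine_eq_mul_of_sq_eq {n : ℕ} (κ : MvPolynomial (Fin n) ℝ) {a b c : ℝ}
    (hne : a ≠ 0 ∨ b ≠ 0 ∨ c ≠ 0) (hsq : a * c = b * b) :
    ∃ a' b' : ℝ, (a', b') ≠ (0, 0) ∧ ∃ κ' : MvPolynomial (Fin n) ℝ,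
      symmBiaffine (κ * C a) (κ * C b) (κ * C c) = rename Sum.inr κ' *
        ((C a' + C b' * X (Sum.inl 0)) * (C a' + C b' * X (Sum.inl 1))) := by
  rw [symmBiaffine_mul_C]
  by_cases ha : a = 0
  · subst ha
    obtain rfl : b = 0 := by simpa using hsq.symm
    refine ⟨0, 1, by simp, κ * C c, ?_⟩
    simp only [map_mul, rename_C, map_zero, map_one]
    ring
  · refine ⟨a, b, by simp [ha], κ * C a⁻¹, ?_⟩
    have hinv : (C a⁻¹ * C a : MvPolynomial (Fin 2 ⊕ Fin n) ℝ) = 1 := by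
      rw [← C_mul, inv_mul_cancel₀ ha, C_1]
    have hC : (C a * C c : MvPolynomial (Fin 2 ⊕ Fin n) ℝ) = C b * C b := by
      rw [← C_mul, ← C_mul, hsq]
    simp only [map_mul, rename_C]
    linear_combination -rename Sum.inr κ * (C a + C b * (X (Sum.inl 0) + X (Sum.inl 1)) +
      C c * (X (Sum.inl 0) * X (Sum.inl 1))) * hinv +
      rename Sum.inr κ * C a⁻¹ * X (Sum.inl 0) * X (Sum.inl 1) * hC

/-- `d = 2`, `γ ∈ ℝ[x₁,x₂,y₁,…,y_n]` multiaffine and symmetric in `x₁,x₂`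
(so `γ = α₀ + α₁(x₁+x₂) + α₂x₁x₂` with `α_i ∈ ℝ[y₁,…,y_n]`). Then:
(a) `G₁₂` and `H₁₂` are linearly dependent over `ℝ(x₂)` iff
`γ = κ·(a + b(x₁+x₂) + c x₁x₂)` for some `a, b, c ∈ ℝ` and `κ ∈ ℝ[y₁,…,y_n]`; and
(b) `γ` and `∂γ/∂x₁` are linearly dependent over `ℝ(x₁)` iff
`γ = κ·(a + b x₁)(a + b x₂)` for some `a, b ∈ ℝ` not both zero and `κ ∈ ℝ[y₁,…,y_n]`. -/
theorem statement11 (n : ℕ)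
    (γ : MvPolynomial (Fin 2 ⊕ Fin n) ℝ)
    (hma : MultiAffine γ) (hsym : SymmInX 2 n γ) :
    (LinDepOver 2 n (Sum.inl 1) (substXX 2 n 0 1 γ)
        (substXX 2 n 0 1 (MvPolynomial.pderiv (Sum.inl 0) γ)) ↔
      ∃ a b c : ℝ, ∃ κ : MvPolynomial (Fin n) ℝ,
        γ = MvPolynomial.rename Sum.inr κ *
          (MvPolynomial.C a +
            MvPolynomial.C b * (MvPolynomial.X (Sum.inl 0) + MvPolynomial.X (Sum.inl 1)) +
            MvPolynomial.C c * (MvPolynomial.X (Sum.inl 0) * MvPolynomial.X (Sum.inl 1)))) ∧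
    (LinDepOver 2 n (Sum.inl 0) γ (MvPolynomial.pderiv (Sum.inl 0) γ) ↔
      ∃ a b : ℝ, (a, b) ≠ (0, 0) ∧ ∃ κ : MvPolynomial (Fin n) ℝ,
        γ = MvPolynomial.rename Sum.inr κ *
          ((MvPolynomial.C a + MvPolynomial.C b * MvPolynomial.X (Sum.inl 0)) *
            (MvPolynomial.C a + MvPolynomial.C b * MvPolynomial.X (Sum.inl 1)))) := by
  obtain ⟨α₀, α₁, α₂, rfl⟩ := hma.exists_eq_symmBiaffine hsym
  refine ⟨⟨fun h => ?_, ?_⟩, ⟨fun h => ?_, ?_⟩⟩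
  · have hm := minors_of_linDepOver_substXX h
    rcases symmBiaffine_eq_zero_or_exists α₀ α₁ α₂ (fun y y' => (hm y y').1)
      (fun y y' => (hm y y').2.1) (fun y y' => (hm y y').2.2) with h0 | ⟨y, κ, -, hκ⟩
    · exact ⟨0, 0, 0, 0, by simp [h0]⟩
    · exact ⟨_, _, _, κ, hκ.trans (symmBiaffine_mul_C ..)⟩
  · rintro ⟨a, b, c, κ, h⟩
    rw [h, ← symmBiaffine_mul_C]
    exact linDepOver_substXX_mul_C κ a b c
  · have hm := minors_of_linDepOver_pderiv h
    rcases symmBiaffine_eq_zero_or_exists α₀ α₁ α₂ (fun y y' => (hm y y').1)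
      (fun y y' => by linarith [(hm y y').2.1, (hm y' y).2.1])
      (fun y y' => (hm y y').2.2) with h0 | ⟨y, κ, hne, hκ⟩
    · exact ⟨1, 0, by simp, 0, by simp [h0]⟩
    · rw [hκ]
      exact exists_symmBiaffine_eq_mul_of_sq_eq κ hne (hm y y).2.1
  · rintro ⟨a, b, hab, κ, h⟩
    rw [h]
    exact linDepOver_pderiv_mul κ hab

end
end

section
/- Let m = 2. The set of real polynomials A of degree at most 4 satisfying the ODE identically (i.e. (a+2bx+cx²)² A''(x) − 6(b+cx)(a+2bx+cx²) A'(x) + 12 (b+cx)² A(x) = 0 for all x ∈ ℝ) is exactly the 2-dimensional real vector space spanned by the two polynomials (b+cx)·(ac−b² + (b+cx)²) and (ac−b²)² − (b+cx)⁴. -/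
noncomputable section

open Polynomial

/-- The left-hand side of the ODE
`(a+2bx+cx²)² A''(x) − (m+1)(2b+2cx)(a+2bx+cx²) A'(x) + (m+1)(m+2)(b+cx)² A(x)`,
evaluated at `x`, for a real polynomial `A`. -/
def odeLHS (m : ℕ) (a b c : ℝ) (A : Polynomial ℝ) (x : ℝ) : ℝ :=
  (a + 2 * b * x + c * x ^ 2) ^ 2 * A.derivative.derivative.eval x
    - ((m : ℝ) + 1) * (2 * b + 2 * c * x) * (a + 2 * b * x + c * x ^ 2) *
        A.derivative.eval x
    + ((m : ℝ) + 1) * ((m : ℝ) + 2) * (b + c * x) ^ 2 * A.eval x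

/-- `(b+cx)·(ac−b² + (b+cx)²)`. -/
def sol1 (a b c : ℝ) : Polynomial ℝ :=
  (C b + C c * X) * (C (a * c - b ^ 2) + (C b + C c * X) ^ 2)

/-- `(ac−b²)² − (b+cx)⁴`. -/
def sol2 (a b c : ℝ) : Polynomial ℝ :=
  C ((a * c - b ^ 2) ^ 2) - (C b + C c * X) ^ 4

/-- Every polynomial of degree at most `4` is a quartic in `b + cx`. -/
theorem exists_eq_quartic_in_linear (b c : ℝ) (hc : c ≠ 0) (A : Polynomial ℝ)
    (hA : A.natDegree ≤ 4) :
    ∃ e₀ e₁ e₂ e₃ e₄ : ℝ, A = C e₀ + C e₁ * (C b + C c * X) + C e₂ * (C b + C c * X) ^ 2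
      + C e₃ * (C b + C c * X) ^ 3 + C e₄ * (C b + C c * X) ^ 4 := by
  set B : Polynomial ℝ := A.comp (C c⁻¹ * (X - C b)) with hB
  have hBA : B.comp (C b + C c * X) = A := by
    rw [hB, comp_assoc]
    have hX : (C c⁻¹ * (X - C b)).comp (C b + C c * X) = (X : Polynomial ℝ) := by
      simp only [mul_comp, C_comp, sub_comp, X_comp, add_sub_cancel_left]
      rw [← mul_assoc, ← C_mul, inv_mul_cancel₀ hc, C_1, one_mul]
    rw [hX, comp_X]
  have hlin : (C c⁻¹ * (X - C b)).natDegree ≤ 1 := by compute_degree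
  have hdeg : B.natDegree < 5 := by
    have hle : B.natDegree ≤ _ := natDegree_comp_le
    nlinarith
  refine ⟨B.coeff 0, B.coeff 1, B.coeff 2, B.coeff 3, B.coeff 4, ?_⟩
  conv_lhs => rw [← hBA, B.as_sum_range_C_mul_X_pow' hdeg]
  simp [Finset.sum_range_succ]

/-- The ODE in the variable `t = b + cx`, for a quartic in `t`. -/
theorem odeLHS_two_quartic (a b c : ℝ) (hc : c ≠ 0) (e₀ e₁ e₂ e₃ e₄ t : ℝ) :
    odeLHS 2 a b c (C e₀ + C e₁ * (C b + C c * X) + C e₂ * (C b + C c * X) ^ 2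
      + C e₃ * (C b + C c * X) ^ 3 + C e₄ * (C b + C c * X) ^ 4) ((t - b) / c) =
    (a * c - b ^ 2 + t ^ 2) ^ 2 * (2 * e₂ + 6 * e₃ * t + 12 * e₄ * t ^ 2)
      - 6 * t * (a * c - b ^ 2 + t ^ 2) * (e₁ + 2 * e₂ * t + 3 * e₃ * t ^ 2 + 4 * e₄ * t ^ 3)
      + 12 * t ^ 2 * (e₀ + e₁ * t + e₂ * t ^ 2 + e₃ * t ^ 3 + e₄ * t ^ 4) := by
  obtain ⟨x, rfl⟩ : ∃ x, t = b + c * x := ⟨(t - b) / c, by field_simp; ring⟩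
  have hx : (b + c * x - b) / c = x := by field_simp; ring
  rw [hx]
  simp [odeLHS, derivative_pow]
  ring

/-- for `m = 2`, the real polynomials of degree at most `4` solving the ODE
identically form exactly the 2-dimensional real vector space spanned by
`(b+cx)(ac−b²+(b+cx)²)` and `(ac−b²)² − (b+cx)⁴`. -/
theorem statement13 (a b c : ℝ) (hc : c ≠ 0) (hdisc : b ^ 2 - a * c < 0) :
    LinearIndependent ℝ ![sol1 a b c, sol2 a b c] ∧
    ∀ A : Polynomial ℝ,
      (A.natDegree ≤ 4 ∧ ∀ x : ℝ, odeLHS 2 a b c A x = 0) ↔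
      ∃ u v : ℝ, A = u • sol1 a b c + v • sol2 a b c := by
  have hd : 0 < a * c - b ^ 2 := by linarith
  refine ⟨?_, fun A => ⟨?_, ?_⟩⟩
  · rw [LinearIndependent.pair_iff]
    intro u v h
    have heval (t : ℝ) : u * (t * (a * c - b ^ 2 + t ^ 2))
        + v * ((a * c - b ^ 2) ^ 2 - t ^ 4) = 0 := by
      have ht := congrArg (eval ((t - b) / c)) h
      have hx : b + c * ((t - b) / c) = t := by field_simp; ring
      simpa [sol1, sol2, hx] using ht
    have hv : v = 0 := by simpa [hd.ne'] using heval 0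
    have hu := heval 1
    have hd1 : a * c - b ^ 2 + 1 ≠ 0 := by positivity
    exact ⟨by simpa [hv, hd1] using hu, hv⟩
  · rintro ⟨hA, hode⟩
    obtain ⟨e₀, e₁, e₂, e₃, e₄, rfl⟩ := exists_eq_quartic_in_linear b c hc A hA
    have h (t : ℝ) := (odeLHS_two_quartic a b c hc e₀ e₁ e₂ e₃ e₄ t).symm.trans (hode _)
    generalize hdd : a * c - b ^ 2 = d at *
    have h₂ : e₂ = 0 := by simpa [hd.ne'] using h 0
    subst h₂
    have h₁ : d * (e₁ - d * e₃) = 0 := by linarith [h 1, h (-1), h 2, h (-2), h 3, h (-3)]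
    have h₀ : e₀ + d ^ 2 * e₄ = 0 := by linarith [h 1, h (-1), h 2, h (-2), h 3, h (-3)]
    obtain rfl : e₁ = d * e₃ := by
      linarith [(mul_eq_zero.mp h₁).resolve_left hd.ne']
    obtain rfl : e₀ = -(d ^ 2 * e₄) := by linarith
    refine ⟨e₃, -e₄, ?_⟩
    simp only [sol1, sol2, hdd, smul_eq_C_mul, C_neg, C_mul, C_pow, C_0]
    ring
  · rintro ⟨u, v, rfl⟩
    refine ⟨by unfold sol1 sol2; compute_degree, fun x => ?_⟩
    simp [odeLHS, sol1, sol2, derivative_pow]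
    ring

end
end

section
/- If m = 3, the only real polynomial of degree at most 5 satisfying the ODE identically is the zero polynomial; and if m ≥ 4, the only real polynomial of degree at most 3 satisfying the ODE identically is the zero polynomial. -/
noncomputable section

open Polynomial

/-- The polynomial `a + 2bX + cX²`. -/
def quad (a b c : ℝ) : ℝ[X] := C a + C (2 * b) * X + C c * X ^ 2

lemma derivative_quad (a b c : ℝ) :
    derivative (quad a b c) = 2 * (C b + C c * X) := by
  simp only [quad, derivative_add, derivative_C, derivative_C_mul, derivative_X, derivative_X_sq]
  simp only [map_mul, map_ofNat]
  ring

lemma sq_half_derivative_quad (a b c : ℝ) :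
    (C b + C c * X) ^ 2 = C (b ^ 2 - a * c) + C c * quad a b c := by
  simp only [quad, map_sub, map_mul, map_pow, map_ofNat]
  ring

lemma natDegree_quad {a b c : ℝ} (hc : c ≠ 0) : (quad a b c).natDegree = 2 := by
  have h : quad a b c = C c * X ^ 2 + C (2 * b) * X + C a := by
    unfold quad
    ring
  rw [h, natDegree_quadratic hc]

lemma mul_derivative_pow_mul {R : Type*} [CommRing R] (Q B : R[X]) (k : ℕ) :
    Q * derivative (Q ^ k * B) = Q ^ k * ((k : R[X]) * derivative Q * B + Q * derivative B) := by
  cases k with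
  | zero => simp
  | succ k =>
    simp only [derivative_mul, derivative_pow_succ, map_add, map_natCast, map_one]
    push_cast
    ring

/-- A polynomial solution of the ODE satisfies it as an identity of polynomials. -/
lemma polynomial_ode_of_odeLHS_eq_zero {m : ℕ} {a b c : ℝ} {A : ℝ[X]}
    (h : ∀ x : ℝ, odeLHS m a b c A x = 0) :
    quad a b c ^ 2 * derivative (derivative A)
      - ((m : ℝ[X]) + 1) * (2 * (C b + C c * X)) * quad a b c * derivative A
      + ((m : ℝ[X]) + 1) * ((m : ℝ[X]) + 2) * (C b + C c * X) ^ 2 * A = 0 := by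
  refine Polynomial.funext fun x => ?_
  rw [eval_zero, ← h x]
  simp only [odeLHS, quad, eval_add, eval_sub, eval_mul, eval_pow, eval_C, eval_X, eval_natCast,
    eval_one, eval_ofNat]
  ring

/-- If the indicial polynomial of the ODE at the roots of `quad a b c` does not vanish at `k`, then
the order of vanishing of a polynomial solution along `quad a b c` is not `k`. -/
lemma quad_pow_succ_dvd {m : ℕ} {a b c : ℝ} (hc : c ≠ 0) (hdisc : b ^ 2 - a * c ≠ 0) {A : ℝ[X]}
    (h : ∀ x : ℝ, odeLHS m a b c A x = 0) {k : ℕ}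
    (hk : 4 * (k : ℝ) * (k - m - 2) + (m + 1) * (m + 2) ≠ 0) (hA : quad a b c ^ k ∣ A) :
    quad a b c ^ (k + 1) ∣ A := by
  obtain ⟨B, rfl⟩ := hA
  have hode := polynomial_ode_of_odeLHS_eq_zero h
  have hsq := sq_half_derivative_quad a b c
  have hQ' := derivative_quad a b c
  have hQ : quad a b c ≠ 0 := by
    intro h0
    have := natDegree_quad (a := a) (b := b) hc
    simp [h0] at this
  generalize quad a b c = Q at *
  generalize C b + C c * X = P at *
  have h1 := mul_derivative_pow_mul Q B k
  rw [hQ'] at h1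
  obtain ⟨E, hE⟩ : ∃ E, E = (k : ℝ[X]) * (2 * P) * B + Q * derivative B := ⟨_, rfl⟩
  rw [← hE] at h1
  have h2 := mul_derivative_pow_mul Q E k
  rw [← h1, derivative_mul, hQ'] at h2
  have h3 : Q ^ k * (((k : ℝ[X]) - m - 2) * (2 * P) * E + Q * derivative E
      + ((m : ℝ[X]) + 1) * (m + 2) * P ^ 2 * B) = 0 := by
    linear_combination hode - h2 + ((m : ℝ[X]) + 2) * (2 * P) * h1
  have h4 := (mul_eq_zero.mp h3).resolve_left (pow_ne_zero k hQ)
  set n : ℝ := 4 * (k : ℝ) * (k - m - 2) + (m + 1) * (m + 2) with hn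
  have hCn : C n = 4 * (k : ℝ[X]) * (k - m - 2) + (m + 1) * (m + 2) := by
    simp only [hn, map_add, map_mul, map_sub, map_natCast, map_one, map_ofNat]
  have h5 : C (n * (b ^ 2 - a * c)) * B =
      Q * -(C n * C c * B + ((k : ℝ[X]) - m - 2) * (2 * P) * derivative B + derivative E) := by
    rw [C_mul]
    linear_combination h4 - C n * B * hsq + P ^ 2 * B * hCn
      - ((k : ℝ[X]) - m - 2) * (2 * P) * hE
  have hu : IsUnit (C (n * (b ^ 2 - a * c))) := isUnit_C.mpr (mul_ne_zero hk hdisc).isUnit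
  rw [pow_succ]
  exact mul_dvd_mul_left _ (hu.dvd_mul_left.mp ⟨_, h5⟩)

lemma eq_zero_of_quad_pow_dvd {a b c : ℝ} (hc : c ≠ 0) {A : ℝ[X]} {k : ℕ}
    (hA : quad a b c ^ k ∣ A) (hdeg : A.natDegree < 2 * k) : A = 0 := by
  refine eq_zero_of_dvd_of_natDegree_lt hA ?_
  rw [natDegree_pow, natDegree_quad hc]
  lia

/-- if `m = 3`, the only real polynomial of degree at most `5` satisfying
the ODE identically is the zero polynomial; and if `m ≥ 4`, the only real polynomial of
degree at most `3` satisfying the ODE identically is the zero polynomial. -/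
theorem statement14 (a b c : ℝ) (hc : c ≠ 0) (hdisc : b ^ 2 - a * c < 0) :
    (∀ A : Polynomial ℝ, A.natDegree ≤ 5 →
      (∀ x : ℝ, odeLHS 3 a b c A x = 0) → A = 0) ∧
    (∀ m : ℕ, 4 ≤ m → ∀ A : Polynomial ℝ, A.natDegree ≤ 3 →
      (∀ x : ℝ, odeLHS m a b c A x = 0) → A = 0) := by
  have hd := hdisc.ne
  refine ⟨fun A hdeg h => ?_, fun m hm A hdeg h => ?_⟩
  · have h1 := quad_pow_succ_dvd hc hd h (k := 0) (by norm_num) (by simp)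
    have h2 := quad_pow_succ_dvd hc hd h (by norm_num) h1
    have h3 := quad_pow_succ_dvd hc hd h (by norm_num) h2
    exact eq_zero_of_quad_pow_dvd hc h3 (by lia)
  · have hm' : (4 : ℝ) ≤ m := by exact_mod_cast hm
    have h1 := quad_pow_succ_dvd hc hd h (k := 0) (by norm_num; constructor <;> positivity)
      (by simp)
    have h2 := quad_pow_succ_dvd hc hd h (by norm_num; nlinarith) h1
    exact eq_zero_of_quad_pow_dvd hc h2 (by lia)

end
end

section
/- For all r, s ∈ {1,…,m}: ∑_{j=1}^m x_j^(m−s) · σ_{r−1}(x̂_j) / Δ_j = (−1)^(s−1) if r = s, and = 0 if r ≠ s. -/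
noncomputable section

/-- The `r`-th elementary symmetric function of the values of `x` over the finite set `s`. -/
def esymmOn {n : ℕ} (s : Finset (Fin n)) (x : Fin n → ℝ) (r : ℕ) : ℝ :=
  ∑ t ∈ s.powersetCard r, ∏ i ∈ t, x i

/-- `σ_r(x₁,…,x_n)`, the `r`-th elementary symmetric polynomial of `x₁,…,x_n`. -/
def esymm {n : ℕ} (x : Fin n → ℝ) (r : ℕ) : ℝ :=
  esymmOn Finset.univ x r

/-- `σ_r(x̂_j)`, the `r`-th elementary symmetric polynomial of the `n - 1` numbers
`x_i`, `i ≠ j`. -/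
def esymmHat {n : ℕ} (x : Fin n → ℝ) (j : Fin n) (r : ℕ) : ℝ :=
  esymmOn (Finset.univ.erase j) x r

/-- `Δ_j(x) = ∏_{i ≠ j} (x_j - x_i)` (an empty product being `1`). -/
def Delta {n : ℕ} (x : Fin n → ℝ) (j : Fin n) : ℝ :=
  ∏ i ∈ Finset.univ.erase j, (x j - x i)

/-- Vandermonde identity: for pairwise distinct reals `x₁,…,x_m` and all
`r, s ∈ {1,…,m}`: `∑_{j=1}^m x_j^(m−s) σ_{r−1}(x̂_j)/Δ_j = (−1)^(s−1)` if `r = s`,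
and `= 0` if `r ≠ s`. -/
theorem statement15 (m : ℕ) (hm : 1 ≤ m)
    (x : Fin m → ℝ) (hx : Function.Injective x)
    (r s : ℕ) (hr1 : 1 ≤ r) (hrm : r ≤ m) (hs1 : 1 ≤ s) (hsm : s ≤ m) :
    ∑ j : Fin m, x j ^ (m - s) * esymmHat x j (r - 1) / Delta x j
      = if r = s then (-1 : ℝ) ^ (s - 1) else 0 := by
  obtain ⟨k, rfl⟩ : ∃ k, r = k + 1 := ⟨r - 1, by omega⟩
  have hdeg : (Polynomial.X ^ (m - s) : Polynomial ℝ).degree < (Finset.univ : Finset (Fin m)).card := by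
    rw [Polynomial.degree_X_pow, Finset.card_fin]
    exact_mod_cast (by omega : m - s < m)
  have key := Lagrange.eval_iterate_derivative_eq_sum (s := Finset.univ) hx.injOn hdeg
    (k := m - (k + 1)) (by rw [Finset.card_fin]; omega) 0
  have hprod (j : Fin m) :
      ∑ t ∈ (Finset.univ.erase j).powersetCard k, ∏ a ∈ t, (0 - x a)
        = (-1) ^ k * esymmHat x j k := by
    rw [esymmHat, esymmOn, Finset.mul_sum]
    refine Finset.sum_congr rfl fun t ht => ?_
    simp only [zero_sub, Finset.prod_neg, (Finset.mem_powersetCard.mp ht).2]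
  rw [Finset.card_fin, show m - (m - (k + 1) + 1) = k by omega, ← Polynomial.coeff_zero_eq_eval_zero,
    Polynomial.coeff_iterate_derivative, zero_add, Nat.descFactorial_self, nsmul_eq_mul,
    Polynomial.coeff_X_pow] at key
  have key' := mul_left_cancel₀ (Nat.cast_ne_zero.mpr (Nat.factorial_ne_zero _)) key
  simp only [hprod, Polynomial.eval_pow, Polynomial.eval_X] at key'
  have hsq : ((-1 : ℝ) ^ k) * (-1) ^ k = 1 := by rw [← mul_pow]; simp
  calc ∑ j : Fin m, x j ^ (m - s) * esymmHat x j k / Delta x j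
      = (-1) ^ k * ∑ j : Fin m, x j ^ (m - s) / (∏ i ∈ Finset.univ.erase j, (x j - x i))
          * ((-1) ^ k * esymmHat x j k) := by
        rw [Finset.mul_sum]
        refine Finset.sum_congr rfl fun j _ => ?_
        rw [Delta]
        linear_combination
          -(x j ^ (m - s) * esymmHat x j k / ∏ i ∈ Finset.univ.erase j, (x j - x i)) * hsq
    _ = if k + 1 = s then (-1 : ℝ) ^ (s - 1) else 0 := by
        rw [← key']
        by_cases h : k + 1 = s
        · subst h
          simp
        · rw [if_neg h, if_neg (by omega), mul_zero]

end
end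

section
/- For all r, s ∈ {1,…,m} and l ∈ {0,…,m}: ∑_{j=1}^m σ_{r−1}(x̂_j) · σ_{s−1}(x̂_j) · x_j^(m−l) / Δ_j equals (−1)^l · σ_{r+s−l−1} if both r ≥ l+1 and s ≥ l+1; equals (−1)^(l−1) · σ_{r+s−l−1} if both r ≤ l and s ≤ l; and equals 0 otherwise (with the convention σ_j = 0 for j < 0 or j > m). In particular, this sum is a linear combination of 1, σ₁, …, σ_m. -/
noncomputable section

/-- `σ_j` for an integer index `j`, with the convention `σ_j = 0` for `j < 0`
(and automatically `σ_j = 0` for `j > m`). -/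
def esymmZ {n : ℕ} (x : Fin n → ℝ) (j : ℤ) : ℝ :=
  if 0 ≤ j then esymm x j.toNat else 0

/-- The sum `∑ j, σ_p(x̂_j) σ_q(x̂_j) x_j ^ k / Δ_j`. -/
def hatSum {m : ℕ} (x : Fin m → ℝ) (p q k : ℕ) : ℝ :=
  ∑ j, esymmHat x j p * esymmHat x j q * x j ^ k / Delta x j

lemma esymmOn_zero {m : ℕ} (s : Finset (Fin m)) (x : Fin m → ℝ) : esymmOn s x 0 = 1 := by
  simp [esymmOn]

lemma esymmOn_eq_zero {m : ℕ} {s : Finset (Fin m)} (x : Fin m → ℝ) {r : ℕ} (h : s.card < r) :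
    esymmOn s x r = 0 := by
  simp [esymmOn, Finset.powersetCard_eq_empty.2 h]

lemma esymmOn_insert_succ {m : ℕ} {s : Finset (Fin m)} (x : Fin m → ℝ) {j : Fin m} (hj : j ∉ s)
    (r : ℕ) : esymmOn (insert j s) x (r + 1) = esymmOn s x (r + 1) + x j * esymmOn s x r := by
  simp only [esymmOn, ← Finset.esymm_map_val, Finset.insert_val_of_notMem hj, Multiset.map_cons,
    Multiset.esymm, Multiset.powersetCard_cons, Multiset.map_add, Multiset.sum_add,
    Multiset.map_map, Function.comp_def, Multiset.prod_cons, Multiset.sum_map_mul_left]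

lemma esymm_succ_eq_esymmHat {m : ℕ} (x : Fin m → ℝ) (j : Fin m) (r : ℕ) :
    esymm x (r + 1) = esymmHat x j (r + 1) + x j * esymmHat x j r := by
  rw [esymmHat, esymmHat, ← esymmOn_insert_succ x (Finset.notMem_erase j _),
    Finset.insert_erase (Finset.mem_univ j), esymm]

lemma esymmZ_zero {m : ℕ} (x : Fin m → ℝ) : esymmZ x 0 = 1 := by
  simp [esymmZ, esymm, esymmOn_zero]

lemma esymmZ_of_neg {m : ℕ} (x : Fin m → ℝ) {j : ℤ} (h : j < 0) : esymmZ x j = 0 := by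
  simp [esymmZ, h]

lemma esymmZ_natCast_add_one {m : ℕ} (x : Fin m → ℝ) (j : ℕ) :
    esymmZ x ((j : ℤ) + 1) = esymm x (j + 1) := by
  rw [esymmZ, if_pos (by positivity)]
  rfl

lemma hatSum_comm {m : ℕ} (x : Fin m → ℝ) (p q k : ℕ) : hatSum x p q k = hatSum x q p k := by
  simp only [hatSum, mul_comm (esymmHat x _ p)]

lemma hatSum_succ {m : ℕ} (x : Fin m → ℝ) (p q k : ℕ) :
    hatSum x p q (k + 1) = esymm x (p + 1) * hatSum x 0 q k - hatSum x (p + 1) q k := by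
  simp only [hatSum, Finset.mul_sum, ← Finset.sum_sub_distrib]
  refine Finset.sum_congr rfl fun j _ => ?_
  rw [esymm_succ_eq_esymmHat x j, show esymmHat x j 0 = 1 from esymmOn_zero _ _]
  ring

lemma coeff_lagrange_basis {m : ℕ} (x : Fin m → ℝ) (j : Fin m) {q : ℕ} (hq : q < m) :
    (Lagrange.basis Finset.univ x j).coeff (m - 1 - q) =
      (-1) ^ q * esymmHat x j q / Delta x j := by
  have hcard : (((Finset.univ.erase j).val.map x)).card = m - 1 := by simp
  have h : Lagrange.basis Finset.univ x j = Polynomial.C (Delta x j)⁻¹ *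
      (((Finset.univ.erase j).val.map x).map fun t => Polynomial.X - Polynomial.C t).prod := by
    simp only [Lagrange.basis, Lagrange.basisDivisor, Finset.prod_mul_distrib, Delta,
      Multiset.map_map, ← Finset.prod_inv_distrib, map_prod]
    rfl
  rw [h, Polynomial.coeff_C_mul, Multiset.prod_X_sub_C_coeff _ (by omega), hcard,
    Finset.esymm_map_val, show m - 1 - (m - 1 - q) = q by omega, esymmHat, esymmOn]
  ring

lemma hatSum_zero_left {m : ℕ} {x : Fin m → ℝ} (hx : Function.Injective x) (q : ℕ) {k : ℕ}
    (hk : k < m) : hatSum x 0 q k = if q + k + 1 = m then (-1) ^ q else 0 := by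
  rcases lt_or_ge q m with hq | hq
  · have h := Lagrange.eq_interpolate (s := Finset.univ) (v := x)
      (f := (Polynomial.X ^ k : Polynomial ℝ)) hx.injOn (by simpa using hk)
    have hc := congrArg (fun f => (-1) ^ q * Polynomial.coeff f (m - 1 - q)) h
    simp only [Lagrange.interpolate_apply, Polynomial.finsetSum_coeff, Polynomial.coeff_C_mul,
      coeff_lagrange_basis x _ hq, Polynomial.eval_pow, Polynomial.eval_X, Polynomial.coeff_X_pow,
      Finset.mul_sum] at hc
    calc hatSum x 0 q k = _ := Finset.sum_congr rfl fun j _ => ?_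
      _ = _ := hc.symm
      _ = _ := ?_
    · rw [show esymmHat x j 0 = 1 from esymmOn_zero _ _]
      have : ((-1 : ℝ) ^ q) * (-1) ^ q = 1 := by rw [← mul_pow]; simp
      linear_combination (-(esymmHat x j q * x j ^ k / Delta x j)) * this
    · rw [mul_ite, mul_one, mul_zero]
      exact if_congr (by omega) rfl rfl
  · rw [if_neg (by omega)]
    refine Finset.sum_eq_zero fun j _ => ?_
    rw [show esymmHat x j q = 0 from esymmOn_eq_zero x (by
      rw [Finset.card_erase_of_mem (Finset.mem_univ j), Finset.card_fin]
      have := j.pos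
      omega)]
    simp

lemma hatSum_succ_left {m : ℕ} (x : Fin m → ℝ) (p q k : ℕ) :
    hatSum x (p + 1) q k = hatSum x p (q + 1) k + esymm x (p + 1) * hatSum x 0 q k -
      esymm x (q + 1) * hatSum x 0 p k := by
  have h₁ := hatSum_succ x p q k
  have h₂ := hatSum_succ x q p k
  rw [hatSum_comm x q p, hatSum_comm x (q + 1) p] at h₂
  linarith

lemma hatSum_of_lt {m : ℕ} {x : Fin m → ℝ} (hx : Function.Injective x) {l : ℕ} (hl : l < m)
    (p q : ℕ) : hatSum x p q (m - (l + 1)) =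
      if l < p ∧ l < q then (-1) ^ (l + 1) * esymmZ x ((p : ℤ) + q - l)
      else if p ≤ l ∧ q ≤ l then (-1) ^ l * esymmZ x ((p : ℤ) + q - l) else 0 := by
  induction p generalizing q with
  | zero =>
    rw [hatSum_zero_left hx q (by omega), if_neg (by omega : ¬(l < 0 ∧ l < q))]
    rcases lt_trichotomy q l with h | rfl | h
    · rw [if_neg (by omega), if_pos (by omega), esymmZ_of_neg x (by omega), mul_zero]
    · rw [if_pos (by omega), if_pos (by omega)]
      simp [esymmZ_zero]
    · rw [if_neg (by omega), if_neg (by omega)]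
  | succ p ih =>
    rw [hatSum_succ_left, ih, hatSum_zero_left hx q (by omega), hatSum_zero_left hx p (by omega),
      ← esymmZ_natCast_add_one, ← esymmZ_natCast_add_one,
      if_congr (show q + (m - (l + 1)) + 1 = m ↔ q = l by omega) rfl rfl,
      if_congr (show p + (m - (l + 1)) + 1 = m ↔ p = l by omega) rfl rfl]
    push_cast
    rw [show (p : ℤ) + (q + 1) - l = p + 1 + q - l by ring]
    rcases lt_trichotomy p l with hp | hp | hp <;> rcases lt_trichotomy q l with hq | hq | hq <;>
    · simp (disch := omega) only [if_pos, if_neg]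
      try subst hp
      try subst hq
      ring_nf

lemma hatSum_self {m : ℕ} {x : Fin m → ℝ} (hx : Function.Injective x) (hm : 1 ≤ m) (p q : ℕ) :
    hatSum x p q m = esymmZ x ((p : ℤ) + q + 1) := by
  obtain ⟨n, rfl⟩ : ∃ n, m = n + 1 := ⟨m - 1, by omega⟩
  have h := hatSum_of_lt hx (l := 0) hm (p + 1) q
  rw [hatSum_succ, hatSum_zero_left hx q (by omega)]
  simp only [zero_add, Nat.add_sub_cancel] at h
  rw [h]
  rcases q with - | q
  · simp [esymmZ_natCast_add_one]
  · simp
    ring_nf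

/-- for pairwise distinct reals `x₁,…,x_m`, all `r, s ∈ {1,…,m}` and
`l ∈ {0,…,m}`: `∑_{j=1}^m σ_{r−1}(x̂_j) σ_{s−1}(x̂_j) x_j^(m−l)/Δ_j` equals
`(−1)^l σ_{r+s−l−1}` if `r, s ≥ l+1`; equals `(−1)^(l−1) σ_{r+s−l−1}` if `r, s ≤ l`;
and equals `0` otherwise (with `σ_j = 0` for `j < 0` or `j > m`). In particular this sum
is a linear combination of `1, σ₁, …, σ_m`. -/
theorem statement16 (m : ℕ) (hm : 1 ≤ m)
    (x : Fin m → ℝ) (hx : Function.Injective x)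
    (r s l : ℕ) (hr1 : 1 ≤ r) (hrm : r ≤ m) (hs1 : 1 ≤ s) (hsm : s ≤ m) (hlm : l ≤ m) :
    ∑ j : Fin m, esymmHat x j (r - 1) * esymmHat x j (s - 1) * x j ^ (m - l) / Delta x j
      = if l + 1 ≤ r ∧ l + 1 ≤ s then
          (-1 : ℝ) ^ l * esymmZ x ((r : ℤ) + (s : ℤ) - (l : ℤ) - 1)
        else if r ≤ l ∧ s ≤ l then
          (-1 : ℝ) ^ (l - 1) * esymmZ x ((r : ℤ) + (s : ℤ) - (l : ℤ) - 1)
        else 0 := by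
  obtain ⟨p, rfl⟩ : ∃ p, r = p + 1 := ⟨r - 1, by omega⟩
  obtain ⟨q, rfl⟩ : ∃ q, s = q + 1 := ⟨s - 1, by omega⟩
  change hatSum x p q (m - l) = _
  rcases l with - | l
  · rw [Nat.sub_zero, hatSum_self hx hm, if_pos (by omega), pow_zero, one_mul]
    congr 1
    push_cast
    ring
  · rw [hatSum_of_lt hx hlm]
    simp only [Nat.add_sub_cancel, Nat.succ_le_iff, Nat.lt_succ_iff]
    rw [show ((p + 1 : ℕ) : ℤ) + ((q + 1 : ℕ) : ℤ) - ((l + 1 : ℕ) : ℤ) - 1 = p + q - l by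
      push_cast; ring]

end
end
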